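/- arXiv:1204.0923 — 2 statements merged into one kernel-verified Lean document; each statement's English description precedes it below -/
import Mathlib

section
/- Let a < b be real numbers and let f be twice differentiable on an open interval containing [a,b] with f'' integrable on [a,b]. If |f''| is quasi-convex on [a,b], i.e. |f''(t x + (1−t) y)| ≤ max{ |f''(x)|, |f''(y)| } for all x, y ∈ [a,b] and t ∈ [0,1], then | (f(a)+f(b))/2 − (1/(b−a)) ∫_a^b f(x) dx | ≤ ((b−a)²/12) max{ |f''(a)|, |f''(b)| }. -/
open intervalIntegral in
/-- The integral of the trapezoid-rule kernel `(x - a) * (b - x)`. -/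
lemma integral_sub_mul_sub (a b : ℝ) :
    ∫ x in a..b, (x - a) * (b - x) = (b - a) ^ 3 / 6 := by
  have hderiv : ∀ x ∈ Set.uIcc a b,
      HasDerivAt (fun x => (b - a) * (x - a) ^ 2 / 2 - (x - a) ^ 3 / 3) ((x - a) * (b - x)) x := by
    intro x _
    have h := (hasDerivAt_id' x).sub_const a
    refine ((((h.pow 2).const_mul (b - a)).div_const 2).sub
      ((h.pow 3).div_const 3)).congr_deriv ?_
    push_cast
    ring
  rw [integral_eq_sub_of_hasDerivAt hderiv
    (Continuous.intervalIntegrable (by fun_prop) a b)]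
  ring

open intervalIntegral in
/-- Integrating by parts twice against `(x - a) * (b - x)`: the trapezoid-rule error in terms of
the second derivative. -/
lemma integral_sub_mul_sub_mul_deriv_deriv {a b : ℝ} {f f' f'' : ℝ → ℝ}
    (hf' : ∀ x ∈ Set.uIcc a b, HasDerivAt f (f' x) x)
    (hf'' : ∀ x ∈ Set.uIcc a b, HasDerivAt f' (f'' x) x)
    (hint : IntervalIntegrable f'' MeasureTheory.volume a b) :
    ∫ x in a..b, (x - a) * (b - x) * f'' x = (b - a) * (f a + f b) - 2 * ∫ x in a..b, f x := by
  have hf : IntervalIntegrable f MeasureTheory.volume a b :=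
    (HasDerivAt.continuousOn hf').intervalIntegrable
  have hP : IntervalIntegrable (fun x => (x - a) * (b - x) * f'' x) MeasureTheory.volume a b :=
    hint.continuousOn_mul (by fun_prop)
  have hderiv : ∀ x ∈ Set.uIcc a b,
      HasDerivAt (fun x => (x - a) * (b - x) * f' x - (a + b - 2 * x) * f x)
        ((x - a) * (b - x) * f'' x + 2 * f x) x := by
    intro x hx
    have h := hasDerivAt_id' x
    refine ((((h.sub_const a).mul (h.const_sub b)).mul (hf'' x hx)).sub
      (((h.const_mul 2).const_sub (a + b)).mul (hf' x hx))).congr_deriv ?_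
    simp only [Pi.mul_apply]
    ring
  have h := integral_eq_sub_of_hasDerivAt hderiv (hP.add (hf.const_mul 2))
  rw [integral_add hP (hf.const_mul 2), integral_const_mul] at h
  linear_combination h

theorem stmt_12 (a b : ℝ) (f f' f'' : ℝ → ℝ) (A B : ℝ)
    (hab : a < b) (hA : A < a) (hB : b < B)
    (hf' : ∀ x ∈ Set.Ioo A B, HasDerivAt f (f' x) x)
    (hf'' : ∀ x ∈ Set.Ioo A B, HasDerivAt f' (f'' x) x)
    (hint : IntervalIntegrable f'' MeasureTheory.volume a b)
    (hqc : ∀ x ∈ Set.Icc a b, ∀ y ∈ Set.Icc a b, ∀ t ∈ Set.Icc (0:ℝ) 1,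
      |f'' (t * x + (1 - t) * y)| ≤ max |f'' x| |f'' y|) :
    |(f a + f b) / 2 - (1 / (b - a)) * ∫ x in a..b, f x|
      ≤ ((b - a) ^ 2 / 12) * max |f'' a| |f'' b| := by
  have hpos : 0 < b - a := sub_pos.2 hab
  have hsub : Set.uIcc a b ⊆ Set.Ioo A B := by
    rw [Set.uIcc_of_le hab.le]
    exact Set.Icc_subset_Ioo hA hB
  have hbound : ∀ x ∈ Set.Icc a b, |f'' x| ≤ max |f'' a| |f'' b| := by
    intro x hx
    have h := hqc a (Set.left_mem_Icc.2 hab.le) b (Set.right_mem_Icc.2 hab.le)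
      ((b - x) / (b - a))
      ⟨div_nonneg (by linarith [hx.2]) hpos.le, (div_le_one hpos).2 (by linarith [hx.1])⟩
    have hx' : (b - x) / (b - a) * a + (1 - (b - x) / (b - a)) * b = x := by
      field_simp
      ring
    rwa [hx'] at h
  have hle : |∫ x in a..b, (x - a) * (b - x) * f'' x| ≤
      ∫ x in a..b, (x - a) * (b - x) * max |f'' a| |f'' b| := by
    have hcont : Continuous fun x => (x - a) * (b - x) * max |f'' a| |f'' b| := by fun_prop
    rw [← Real.norm_eq_abs]
    refine intervalIntegral.norm_integral_le_of_norm_le hab.le (.of_forall fun x hx => ?_)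
      (hcont.intervalIntegrable a b)
    have hnn : 0 ≤ (x - a) * (b - x) :=
      mul_nonneg (by linarith [hx.1]) (by linarith [hx.2])
    rw [Real.norm_eq_abs, abs_mul, abs_of_nonneg hnn]
    exact mul_le_mul_of_nonneg_left (hbound x (Set.Ioc_subset_Icc_self hx)) hnn
  rw [intervalIntegral.integral_mul_const, integral_sub_mul_sub] at hle
  have herr : (f a + f b) / 2 - (1 / (b - a)) * ∫ x in a..b, f x =
      (∫ x in a..b, (x - a) * (b - x) * f'' x) / (2 * (b - a)) := by
    rw [integral_sub_mul_sub_mul_deriv_deriv (fun x hx => hf' x (hsub hx))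
      (fun x hx => hf'' x (hsub hx)) hint]
    field_simp
  rw [herr, abs_div, abs_of_pos (by positivity : 0 < 2 * (b - a)), div_le_iff₀ (by positivity)]
  linarith
end

section
/- Let a < b be real numbers, let p > 1 with q = p/(p−1), and let f be twice differentiable on an open interval containing [a,b] with f'' integrable on [a,b]. If |f''|^q is quasi-convex on [a,b], i.e. |f''(t x + (1−t) y)|^q ≤ max{ |f''(x)|^q, |f''(y)|^q } for all x, y ∈ [a,b] and t ∈ [0,1], then | (f(a)+f(b))/2 − (1/(b−a)) ∫_a^b f(x) dx | ≤ ((b−a)²/8) (√π/2)^{1/p} ( Γ(1+p)/Γ(3/2 + p) )^{1/p} ( max{ |f''(a)|^q, |f''(b)|^q } )^{1/q}. -/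
lemma integral_mul_one_sub_rpow {p : ℝ} (hp : 0 ≤ p) :
    ∫ x in (0:ℝ)..1, (x * (1 - x)) ^ p
      = (1 / 4) ^ p * (√Real.pi / 2) * (Real.Gamma (1 + p) / Real.Gamma (3 / 2 + p)) := by
  have hbeta : Complex.betaIntegral ((1 + p : ℝ) : ℂ) ((1 + p : ℝ) : ℂ)
      = ((∫ x in (0:ℝ)..1, (x * (1 - x)) ^ p : ℝ) : ℂ) := by
    rw [Complex.betaIntegral, ← intervalIntegral.integral_ofReal]
    refine intervalIntegral.integral_congr fun x hx => ?_
    rw [Set.uIcc_of_le zero_le_one] at hx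
    have h1 : 0 ≤ 1 - x := by linarith [hx.2]
    simp only [Real.mul_rpow hx.1 h1, Complex.ofReal_mul, Complex.ofReal_cpow hx.1,
      Complex.ofReal_cpow h1]
    push_cast
    ring_nf
  have hg := Complex.Gamma_mul_Gamma_eq_betaIntegral (s := ((1 + p : ℝ) : ℂ))
    (t := ((1 + p : ℝ) : ℂ)) (by rw [Complex.ofReal_re]; linarith)
    (by rw [Complex.ofReal_re]; linarith)
  rw [hbeta, ← Complex.ofReal_add, Complex.Gamma_ofReal, Complex.Gamma_ofReal] at hg
  norm_cast at hg
  have hd := Real.Gamma_mul_Gamma_add_half (1 + p)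
  have hG1 : 0 < Real.Gamma (1 + p) := Real.Gamma_pos_of_pos (by linarith)
  have hG2 : 0 < Real.Gamma (3 / 2 + p) := Real.Gamma_pos_of_pos (by linarith)
  have hG3 : 0 < Real.Gamma (1 + p + (1 + p)) := Real.Gamma_pos_of_pos (by linarith)
  rw [show 1 + p + 1 / 2 = 3 / 2 + p by ring, show 2 * (1 + p) = 1 + p + (1 + p) by ring] at hd
  have h4 : (2:ℝ) ^ (1 - (1 + p + (1 + p))) = (1 / 4) ^ p / 2 := by
    rw [show 1 - (1 + p + (1 + p)) = (-2) * p - 1 by ring, Real.rpow_sub two_pos, Real.rpow_mul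
      two_pos.le, Real.rpow_one]
    norm_num [Real.rpow_neg]
  rw [h4] at hd
  set I := ∫ x in (0:ℝ)..1, (x * (1 - x)) ^ p
  have hI : I = Real.Gamma (1 + p) * Real.Gamma (1 + p) / Real.Gamma (1 + p + (1 + p)) := by
    rw [hg]; field_simp
  rw [hI]
  generalize Real.Gamma (1 + p + (1 + p)) = G at *
  generalize Real.Gamma (3 / 2 + p) = H at *
  field_simp
  linear_combination 2 * hd

lemma one_sixth_rpow_le_integral {p : ℝ} (hp : 1 ≤ p) :
    (1 / 6) ^ p ≤ ∫ x in (0:ℝ)..1, (x * (1 - x)) ^ p := by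
  have hle : ∫ x in (0:ℝ)..1, (1 / 6 : ℝ) ^ p * (1 + p * (6 * (x - x ^ 2) - 1))
      ≤ ∫ x in (0:ℝ)..1, (x * (1 - x)) ^ p := by
    refine intervalIntegral.integral_mono_on zero_le_one
      (Continuous.intervalIntegrable (by fun_prop) _ _)
      (Continuous.intervalIntegrable
        (Continuous.rpow_const (by fun_prop) fun _ => Or.inr (by linarith)) _ _) fun x hx => ?_
    have hx0 : 0 ≤ x * (1 - x) := mul_nonneg hx.1 (by linarith [hx.2])
    have hb := one_add_mul_self_le_rpow_one_add (s := 6 * (x - x ^ 2) - 1) (by nlinarith) hp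
    calc _ ≤ (1 / 6 : ℝ) ^ p * (1 + (6 * (x - x ^ 2) - 1)) ^ p := by gcongr
      _ = (x * (1 - x)) ^ p := by
        rw [← Real.mul_rpow (by norm_num) (by nlinarith)]
        ring_nf
  refine le_trans (le_of_eq ?_) hle
  have h : ∫ x in (0:ℝ)..1, (1 + p * (6 * (x - x ^ 2) - 1)) = 1 := by
    have hd : ∀ x ∈ Set.uIcc (0:ℝ) 1, HasDerivAt
        (fun x : ℝ => x + p * (3 * x ^ 2 - 2 * x ^ 3 - x)) (1 + p * (6 * (x - x ^ 2) - 1)) x := by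
      intro x _
      have h := (hasDerivAt_id x).add (((((hasDerivAt_pow 2 x).const_mul 3).sub
        ((hasDerivAt_pow 3 x).const_mul 2)).sub (hasDerivAt_id x)).const_mul p)
      refine h.congr_deriv ?_
      push_cast
      ring
    rw [intervalIntegral.integral_eq_sub_of_hasDerivAt hd
      (Continuous.intervalIntegrable (by fun_prop) _ _)]
    norm_num
  rw [intervalIntegral.integral_const_mul, h, mul_one]

lemma two_thirds_le_gamma_quotient_rpow {p : ℝ} (hp : 1 ≤ p) :
    2 / 3 ≤ (√Real.pi / 2) ^ (1 / p)
      * (Real.Gamma (1 + p) / Real.Gamma (3 / 2 + p)) ^ (1 / p) := by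
  have hp0 : 0 < p := by linarith
  have hG1 : 0 < Real.Gamma (1 + p) := Real.Gamma_pos_of_pos (by linarith)
  have hG2 : 0 < Real.Gamma (3 / 2 + p) := Real.Gamma_pos_of_pos (by linarith)
  have h := one_sixth_rpow_le_integral hp
  rw [integral_mul_one_sub_rpow hp0.le, mul_assoc] at h
  rw [← Real.mul_rpow (by positivity) (by positivity), one_div,
    Real.le_rpow_inv_iff_of_pos (by norm_num) (by positivity) hp0]
  rw [show (1 / 6 : ℝ) = 1 / 4 * (2 / 3) by norm_num,
    Real.mul_rpow (by norm_num) (by norm_num)] at h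
  exact le_of_mul_le_mul_left h (by positivity)

lemma abs_trapezoid_sub_average_le {a b M : ℝ} {f f' f'' : ℝ → ℝ} (hab : a < b)
    (hf' : ∀ x ∈ Set.Icc a b, HasDerivAt f (f' x) x)
    (hf'' : ∀ x ∈ Set.Icc a b, HasDerivAt f' (f'' x) x)
    (hM : ∀ x ∈ Set.Icc a b, |f'' x| ≤ M) :
    |(f a + f b) / 2 - (1 / (b - a)) * ∫ x in a..b, f x| ≤ (b - a) ^ 2 / 12 * M := by
  have hI : Set.uIcc a b = Set.Icc a b := Set.uIcc_of_le hab.le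
  have hu := uniqueDiffOn_Icc hab
  have hd1 : Set.EqOn (derivWithin f (Set.Icc a b)) f' (Set.Icc a b) := fun x hx =>
    (hf' x hx).hasDerivWithinAt.derivWithin (hu x hx)
  have hd2 : ∀ x ∈ Set.Icc a b,
      HasDerivWithinAt (derivWithin f (Set.Icc a b)) (f'' x) (Set.Icc a b) x := fun x hx =>
    (hf'' x hx).hasDerivWithinAt.congr hd1 (hd1 hx)
  have hM0 : 0 ≤ M := (abs_nonneg _).trans (hM a ⟨le_rfl, hab.le⟩)
  have h := trapezoidal_error_le (f := f) (a := a) (b := b) (ζ := M) (N := 1)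
    (by rw [hI]; exact fun x hx => (hf' x hx).differentiableAt.differentiableWithinAt)
    (by rw [hI]; exact fun x hx => (hd2 x hx).differentiableWithinAt)
    (by
      intro x
      rw [hI, iteratedDerivWithin_succ, iteratedDerivWithin_one]
      by_cases hx : x ∈ Set.Icc a b
      · rw [(hd2 x hx).derivWithin (hu x hx)]
        exact hM x hx
      · rw [derivWithin_zero_of_notMem_closure (by rwa [isClosed_Icc.closure_eq]), abs_zero]
        exact hM0)
    one_pos
  have hba : 0 < b - a := sub_pos.2 hab
  rw [trapezoidal_error, trapezoidal_integral_one, abs_of_pos hba] at h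
  have he : (f a + f b) / 2 - (1 / (b - a)) * ∫ x in a..b, f x
      = ((b - a) / 2 * (f a + f b) - ∫ x in a..b, f x) / (b - a) := by
    field_simp
  rw [he, abs_div, abs_of_pos hba, div_le_iff₀ hba]
  refine h.trans (le_of_eq ?_)
  push_cast
  ring


theorem stmt_13 (a b p q : ℝ) (f f' f'' : ℝ → ℝ) (A B : ℝ)
    (hab : a < b) (hp : 1 < p) (hq : q = p / (p - 1))
    (hA : A < a) (hB : b < B)
    (hf' : ∀ x ∈ Set.Ioo A B, HasDerivAt f (f' x) x)
    (hf'' : ∀ x ∈ Set.Ioo A B, HasDerivAt f' (f'' x) x)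
    (hint : IntervalIntegrable f'' MeasureTheory.volume a b)
    (hqc : ∀ x ∈ Set.Icc a b, ∀ y ∈ Set.Icc a b, ∀ t ∈ Set.Icc (0:ℝ) 1,
      |f'' (t * x + (1 - t) * y)| ^ q ≤ max (|f'' x| ^ q) (|f'' y| ^ q)) :
    |(f a + f b) / 2 - (1 / (b - a)) * ∫ x in a..b, f x|
      ≤ ((b - a) ^ 2 / 8) * (Real.sqrt Real.pi / 2) ^ (1 / p)
          * (Real.Gamma (1 + p) / Real.Gamma (3 / 2 + p)) ^ (1 / p)
          * (max (|f'' a| ^ q) (|f'' b| ^ q)) ^ (1 / q) := by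
  have hp0 : 0 < p := by linarith
  have hq0 : 0 < q := by rw [hq]; exact div_pos hp0 (by linarith)
  have hsub : Set.Icc a b ⊆ Set.Ioo A B := Set.Icc_subset_Ioo hA hB
  have hM : ∀ x ∈ Set.Icc a b, |f'' x| ≤ (max (|f'' a| ^ q) (|f'' b| ^ q)) ^ (1 / q) := by
    intro x hx
    have hba : 0 < b - a := sub_pos.2 hab
    have h := hqc a ⟨le_rfl, hab.le⟩ b ⟨hab.le, le_rfl⟩ ((b - x) / (b - a))
      ⟨div_nonneg (by linarith [hx.2]) hba.le, (div_le_one hba).2 (by linarith [hx.1])⟩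
    rw [show (b - x) / (b - a) * a + (1 - (b - x) / (b - a)) * b = x by field_simp; ring] at h
    rwa [one_div, Real.le_rpow_inv_iff_of_pos (abs_nonneg _) (by positivity) hq0]
  refine (abs_trapezoid_sub_average_le hab (fun x hx => hf' x (hsub hx))
    (fun x hx => hf'' x (hsub hx)) hM).trans ?_
  rw [mul_assoc ((b - a) ^ 2 / 8)]
  refine mul_le_mul_of_nonneg_right ?_ (by positivity)
  have h := mul_le_mul_of_nonneg_left (two_thirds_le_gamma_quotient_rpow hp.le)
    (show 0 ≤ (b - a) ^ 2 / 8 by positivity)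
  linarith
end
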